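/- arXiv:2407.06160 — 2 statements merged into one kernel-verified Lean document; each statement's English description precedes it below -/
import Mathlib

section
/- Let n and k be positive integers and let a_1, ..., a_k be elements of ℤ^n whose ℚ-linear span is all of ℚ^n. Then the group homomorphism φ : (ℂˣ)^n → (ℂˣ)^k defined by φ(t)_i = ∏_{j=1}^n t_j^{(a_i)_j} has finite kernel. -/
/-- A rational linear combination of integer vectors that is itself an integer vector becomes
an integer linear combination after multiplication by a nonzero integer. -/
theorem exists_ne_zero_integer_combination {ι κ : Type*} [Fintype ι] (a : ι → κ → ℤ) (v : κ → ℤ)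
    (hv : (fun l => (v l : ℚ)) ∈
      Submodule.span ℚ (Set.range fun i => fun l => (a i l : ℚ))) :
    ∃ m : ℤ, m ≠ 0 ∧ ∃ d : ι → ℤ, ∀ l, ∑ i, a i l * d i = m * v l := by
  obtain ⟨c, hc⟩ := (Submodule.mem_span_range_iff_exists_fun ℚ).mp hv
  obtain ⟨b, hb⟩ := IsLocalization.exist_integer_multiples_of_finite (nonZeroDivisors ℤ) c
  choose d hd using hb
  refine ⟨b, nonZeroDivisors.coe_ne_zero b, d, fun l => ?_⟩
  have hd' : ∀ i, (d i : ℚ) = (b : ℤ) * c i := fun i => by simpa using hd i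
  have hl : ∑ i, c i * (a i l : ℚ) = v l := by simpa using congrFun hc l
  have : ∑ i, (a i l : ℚ) * d i = (b : ℤ) * v l := by
    rw [← hl, Finset.mul_sum]
    exact Finset.sum_congr rfl fun i _ => by rw [hd' i]; ring
  exact_mod_cast this

/-- In the units of a domain, the solutions of `x ^ m = 1` with `m` a nonzero integer form a
finite set. -/
theorem Units.finite_setOf_zpow_eq_one {R : Type*} [CommRing R] [IsDomain R] {m : ℤ}
    (hm : m ≠ 0) : {x : Rˣ | x ^ m = 1}.Finite := by
  have : NeZero m.natAbs := ⟨Int.natAbs_ne_zero.mpr hm⟩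
  have hfin : Finite (rootsOfUnity m.natAbs R) := inferInstance
  refine (Set.finite_coe_iff.mp hfin).subset fun x hx => ?_
  exact (mem_rootsOfUnity _ _).mpr (pow_natAbs_eq_one.mpr hx)

/-- Let `n` and `k` be positive integers and let `a_1, ..., a_k` be elements of `ℤ^n`
whose `ℚ`-linear span is all of `ℚ^n`. Then the group homomorphism
`φ : (ℂˣ)^n → (ℂˣ)^k` defined by `φ(t)_i = ∏_j t_j ^ (a_i)_j` has finite kernel. -/
theorem torus_character_map_finite_kernel
    (n k : ℕ) (hn : 0 < n) (hk : 0 < k)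
    (a : Fin k → Fin n → ℤ)
    (hspan : Submodule.span ℚ (Set.range fun i => fun j => (a i j : ℚ)) = ⊤)
    (φ : ((Fin n → ℂˣ)) →* (Fin k → ℂˣ))
    (hφ : ∀ t i, φ t i = ∏ j, (t j) ^ (a i j)) :
    (φ.ker : Set (Fin n → ℂˣ)).Finite := by
  have hcomb (j : Fin n) : ∃ m : ℤ, m ≠ 0 ∧ ∃ d : Fin k → ℤ,
      ∀ l, ∑ i, a i l * d i = m * (Pi.single j 1 : Fin n → ℤ) l :=
    exists_ne_zero_integer_combination a _ (hspan ▸ Submodule.mem_top)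
  choose m hm d hd using hcomb
  refine (Set.Finite.pi' fun j => Units.finite_setOf_zpow_eq_one (R := ℂ) (hm j)).subset
    fun t ht j => ?_
  have hker (i : Fin k) : ∏ l, t l ^ a i l = 1 := by
    rw [← hφ, MonoidHom.mem_ker.mp ht, Pi.one_apply]
  calc t j ^ m j = ∏ l, t l ^ (m j * (Pi.single j 1 : Fin n → ℤ) l) := by
        rw [Finset.prod_eq_single j (fun l _ hl => by simp [hl]) (by simp)]
        simp
    _ = ∏ l, ∏ i, (t l ^ a i l) ^ d j i := by
        refine Finset.prod_congr rfl fun l _ => ?_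
        simp_rw [← hd j l, ← zpow_mul]
        exact map_sum (zmultiplesHom (Additive ℂˣ) (Additive.ofMul (t l))) _ _
    _ = ∏ i, (∏ l, t l ^ a i l) ^ d j i := by
        rw [Finset.prod_comm]
        simp_rw [Finset.prod_zpow]
    _ = 1 := by simp [hker]
end

section
/- Let n be a positive integer and let S = {a_1, ..., a_k} ⊆ ℤ^n be a finite set which is symmetric (S = −S) and whose ℚ-linear span is all of ℚ^n. Then the group homomorphism τ : (ℂˣ)^n × ℂˣ → (ℂˣ)^k defined by τ(t, z)_i = z · ∏_{j=1}^n t_j^{(a_i)_j} has finite kernel. -/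
/-- A vector in the `ℚ`-span of integer vectors lying in an additive subgroup `L` has a positive
integer multiple in `L`. -/
theorem exists_pos_smul_mem_of_mem_span_rat {ι κ : Type*} (a : κ → ι → ℤ)
    (L : AddSubgroup (ι → ℤ)) (ha : ∀ i, a i ∈ L) {x : ι → ℚ}
    (hx : x ∈ Submodule.span ℚ (Set.range fun i => fun j => (a i j : ℚ))) :
    ∃ N : ℕ, 0 < N ∧ ∃ b ∈ L, ∀ j, (N : ℚ) * x j = b j := by
  induction hx using Submodule.span_induction with
  | mem x h =>
    obtain ⟨i, rfl⟩ := h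
    exact ⟨1, one_pos, a i, ha i, by simp⟩
  | zero => exact ⟨1, one_pos, 0, L.zero_mem, by simp⟩
  | add x y _ _ hx hy =>
    obtain ⟨N, hN, b, hb, hxb⟩ := hx
    obtain ⟨M, hM, c, hc, hyc⟩ := hy
    refine ⟨N * M, Nat.mul_pos hN hM, (M : ℤ) • b + (N : ℤ) • c,
      L.add_mem (L.zsmul_mem hb M) (L.zsmul_mem hc N), fun j => ?_⟩
    simp only [Pi.add_apply, Pi.smul_apply, smul_eq_mul]
    push_cast
    rw [← hxb, ← hyc]
    ring
  | smul q x _ hx =>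
    obtain ⟨N, hN, b, hb, hxb⟩ := hx
    refine ⟨q.den * N, Nat.mul_pos q.den_pos hN, q.num • b, L.zsmul_mem hb _, fun j => ?_⟩
    simp only [Pi.smul_apply, smul_eq_mul]
    push_cast
    rw [← hxb]
    linear_combination (N : ℚ) * x j * Rat.mul_den_eq_num q

/-- The exponents `b` with `(∏ j, t j ^ b j) ^ m = 1` for all `t ∈ T`. -/
def exponentSubgroup {ι G : Type*} [Fintype ι] [CommGroup G] (T : Set (ι → G)) (m : ℕ) :
    AddSubgroup (ι → ℤ) where
  carrier := {b | ∀ t ∈ T, (∏ j, t j ^ b j) ^ m = 1}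
  zero_mem' := by simp
  add_mem' := by
    intro b c hb hc t ht
    simp [zpow_add, Finset.prod_mul_distrib, mul_pow, hb t ht, hc t ht]
  neg_mem' := by
    intro b hb t ht
    simp [hb t ht]

theorem finite_setOf_units_pow_eq_one {R : Type*} [CommRing R] [IsDomain R] {m : ℕ}
    (hm : 0 < m) : {u : Rˣ | u ^ m = 1}.Finite := by
  have : NeZero m := ⟨hm.ne'⟩
  exact Set.finite_coe_iff.mp (inferInstanceAs (Finite (rootsOfUnity m R)))


/-- Let `n` be a positive integer and let `S = {a_1, ..., a_k} ⊆ ℤ^n` be a finite set which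
is symmetric (`S = -S`) and whose `ℚ`-linear span is all of `ℚ^n`. Then the group
homomorphism `τ : (ℂˣ)^n × ℂˣ → (ℂˣ)^k` defined by
`τ(t, z)_i = z * ∏_j t_j ^ (a_i)_j` has finite kernel. -/
theorem twisted_torus_character_map_finite_kernel
    (n k : ℕ) (hn : 0 < n) (hk : 0 < k)
    (a : Fin k → Fin n → ℤ)
    (hsymm : ∀ i : Fin k, ∃ i' : Fin k, a i' = -a i)
    (hspan : Submodule.span ℚ (Set.range fun i => fun j => (a i j : ℚ)) = ⊤)
    (τ : ((Fin n → ℂˣ) × ℂˣ) →* (Fin k → ℂˣ))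
    (hτ : ∀ t : (Fin n → ℂˣ) × ℂˣ, ∀ i, τ t i = t.2 * ∏ j, (t.1 j) ^ (a i j)) :
    (τ.ker : Set ((Fin n → ℂˣ) × ℂˣ)).Finite := by
  have hker (x) (hx : x ∈ τ.ker) (i) : x.2 * ∏ j, x.1 j ^ a i j = 1 := by
    rw [← hτ, MonoidHom.mem_ker.mp hx, Pi.one_apply]
  have hz (x) (hx : x ∈ τ.ker) : x.2 ^ 2 = 1 := by
    obtain ⟨i, hi⟩ := hsymm ⟨0, hk⟩
    have h := hker x hx i
    simp only [hi, Pi.neg_apply, zpow_neg, Finset.prod_inv_distrib] at h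
    rw [sq]
    nth_rewrite 1 [mul_inv_eq_one.mp h]
    rw [mul_comm, hker x hx]
  have ha (i) : a i ∈ exponentSubgroup (Prod.fst '' (τ.ker : Set ((Fin n → ℂˣ) × ℂˣ))) 2 := by
    rintro _ ⟨x, hx, rfl⟩
    have h := congrArg (· ^ 2) (hker x hx i)
    simpa only [mul_pow, hz x hx, one_mul, one_pow] using h
  have htors (l : Fin n) : ∃ N : ℕ, 0 < N ∧ ∀ x ∈ τ.ker, x.1 l ^ N = 1 := by
    obtain ⟨N, hN, b, hb, h⟩ := exists_pos_smul_mem_of_mem_span_rat a _ ha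
      (x := Pi.single l 1) (hspan ▸ Submodule.mem_top)
    obtain rfl : b = Pi.single l (N : ℤ) := by
      funext j
      have hj := h j
      rcases eq_or_ne j l with rfl | hjl
      · rw [Pi.single_eq_same, mul_one] at hj
        rw [Pi.single_eq_same]
        exact_mod_cast hj.symm
      · simpa [hjl, eq_comm] using hj
    refine ⟨N * 2, by positivity, fun x hx => ?_⟩
    have hxl := hb x.1 ⟨x, hx, rfl⟩
    rw [Finset.prod_eq_single l (by intro j _ hj; simp [hj]) (by simp)] at hxl
    simpa [pow_mul] using hxl
  choose N hN hpow using htors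
  refine ((Set.Finite.pi' fun l => finite_setOf_units_pow_eq_one (R := ℂ) (hN l)).prod
    (finite_setOf_units_pow_eq_one (R := ℂ) two_pos)).subset fun x hx => ?_
  exact ⟨fun l => hpow l x hx, hz x hx⟩
end
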